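/- For all real numbers a, b, c, d with 0 < a, b, c, d < π, the absolutely convergent series Σ_{k=1}^{∞} sin(k a) sin(k b) sin(k c) sin(k d) / k² equals (π/8) times the Lebesgue measure of the intersection I(a,b) ∩ I(c,d), where for x, y ∈ (0, π) the interval I(x,y) denotes the open interval ( |x − y| , min(x + y, 2π − x − y) ). -/

import Mathlib

open Real Filter MeasureTheory

/-- For `x, y ∈ (0, π)`, the open interval `( |x − y| , min(x + y, 2π − x − y) )`. -/
noncomputable def triangleInterval (x y : ℝ) : Set ℝ :=
  Set.Ioo |x - y| (min (x + y) (2 * π - x - y))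

theorem hasSum_cos_div_sq {t : ℝ} (h0 : 0 ≤ t) (h1 : t ≤ 2 * π) :
    HasSum (fun n : ℕ => Real.cos (n * t) / (n : ℝ) ^ 2)
      (π ^ 2 / 6 - π * t / 2 + t ^ 2 / 4) := by
  have hx : t / (2 * π) ∈ Set.Icc (0 : ℝ) 1 :=
    ⟨by positivity, by rw [div_le_one (by positivity)]; exact h1⟩
  have h := hasSum_one_div_nat_pow_mul_cos one_ne_zero hx
  have e := bernoulliFun_two (t / (2 * π))
  unfold bernoulliFun at e
  rw [mul_one, e] at h
  convert h using 1
  · ext n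
    rw [show 2 * π * n * (t / (2 * π)) = n * t by field_simp]
    ring
  · norm_num [Nat.factorial]
    field_simp
    ring

theorem hasSum_cos_mul_cos_div_sq {x y : ℝ} (hx0 : 0 ≤ x) (hxπ : x ≤ π)
    (hy0 : 0 ≤ y) (hyπ : y ≤ π) :
    HasSum (fun n : ℕ => Real.cos (n * x) * Real.cos (n * y) / (n : ℝ) ^ 2)
      (π ^ 2 / 6 - π * max x y / 2 + (x ^ 2 + y ^ 2) / 4) := by
  wlog hxy : y ≤ x generalizing x y
  · have h := this hy0 hyπ hx0 hxπ (le_of_not_ge hxy)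
    convert h using 1
    · ext n
      ring
    · rw [max_comm]
      ring
  have h1 := hasSum_cos_div_sq (t := x - y) (by linarith) (by linarith)
  have h2 := hasSum_cos_div_sq (t := x + y) (by linarith) (by linarith)
  convert! (h1.add h2).div_const 2 using 1
  · ext n
    rw [mul_sub, mul_add, Real.cos_sub, Real.cos_add]
    ring
  · rw [max_eq_left hxy]
    ring

theorem sin_mul_sin_eq_cos_triangleInterval (n : ℕ) (x y : ℝ) :
    Real.sin (n * x) * Real.sin (n * y) =
      (Real.cos (n * |x - y|) - Real.cos (n * min (x + y) (2 * π - x - y))) / 2 := by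
  have h1 : Real.cos (n * |x - y|) = Real.cos (n * x - n * y) := by
    rw [← mul_sub, ← Real.cos_abs (n * (x - y)), abs_mul, Nat.abs_cast]
  have h2 : Real.cos (n * min (x + y) (2 * π - x - y)) = Real.cos (n * x + n * y) := by
    rcases min_choice (x + y) (2 * π - x - y) with h | h
    · rw [h, mul_add]
    · rw [h, show (n : ℝ) * (2 * π - x - y) = n * (2 * π) - (n * x + n * y) by ring,
        Real.cos_nat_mul_two_pi_sub]
  rw [h1, h2, Real.cos_sub, Real.cos_add]
  ring

theorem volume_Ioo_inter_Ioo_toReal {u v p q : ℝ} (huv : u ≤ v) (hpq : p ≤ q) :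
    (volume (Set.Ioo u v ∩ Set.Ioo p q)).toReal =
      max u q + max v p - max u p - max v q := by
  rw [Set.Ioo_inter_Ioo, Real.volume_Ioo, ENNReal.toReal_ofReal']
  grind

theorem triangleInterval_endpoints {x y : ℝ} (hx0 : 0 < x) (hxπ : x < π)
    (hy0 : 0 < y) (hyπ : y < π) :
    |x - y| ≤ min (x + y) (2 * π - x - y) ∧ min (x + y) (2 * π - x - y) ≤ π := by
  grind

theorem hasSum_four_sin_div_sq {a b c d : ℝ} (ha0 : 0 < a) (haπ : a < π)
    (hb0 : 0 < b) (hbπ : b < π) (hc0 : 0 < c) (hcπ : c < π) (hd0 : 0 < d) (hdπ : d < π) :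
    HasSum (fun n : ℕ => Real.sin (n * a) * Real.sin (n * b) * Real.sin (n * c) *
        Real.sin (n * d) / (n : ℝ) ^ 2)
      (π / 8 * (volume (triangleInterval a b ∩ triangleInterval c d)).toReal) := by
  obtain ⟨huv, hv⟩ := triangleInterval_endpoints ha0 haπ hb0 hbπ
  obtain ⟨hpq, hq⟩ := triangleInterval_endpoints hc0 hcπ hd0 hdπ
  have hab := fun n => sin_mul_sin_eq_cos_triangleInterval n a b
  have hcd := fun n => sin_mul_sin_eq_cos_triangleInterval n c d
  have hu := abs_nonneg (a - b)
  have hp := abs_nonneg (c - d)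
  unfold triangleInterval
  rw [volume_Ioo_inter_Ioo_toReal huv hpq]
  generalize |a - b| = u at *
  generalize |c - d| = p at *
  generalize min (a + b) (2 * π - a - b) = v at *
  generalize min (c + d) (2 * π - c - d) = q at *
  have hup := hasSum_cos_mul_cos_div_sq hu (huv.trans hv) hp (hpq.trans hq)
  have huq := hasSum_cos_mul_cos_div_sq hu (huv.trans hv) (hp.trans hpq) hq
  have hvp := hasSum_cos_mul_cos_div_sq (hu.trans huv) hv hp (hpq.trans hq)
  have hvq := hasSum_cos_mul_cos_div_sq (hu.trans huv) hv (hp.trans hpq) hq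
  convert! (((hup.sub huq).sub hvp).add hvq).div_const 4 using 1
  · ext n
    rw [hab n, mul_assoc, hcd n]
    ring
  · ring

/-- Factorization of the physical scalar product on a 4-punctured sphere: the absolutely
convergent series `Σ_{k=1}^∞ sin(k a) sin(k b) sin(k c) sin(k d) / k²` equals `π/8`
times the Lebesgue measure of `I(a,b) ∩ I(c,d)`. -/
theorem four_punctured_sphere_factorization
    (a b c d : ℝ) (ha0 : 0 < a) (haπ : a < π) (hb0 : 0 < b) (hbπ : b < π)
    (hc0 : 0 < c) (hcπ : c < π) (hd0 : 0 < d) (hdπ : d < π) :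
    Summable (fun k : ℕ+ => |Real.sin (k * a) * Real.sin (k * b) * Real.sin (k * c) *
        Real.sin (k * d) / ((k : ℕ) : ℝ) ^ 2|) ∧
    (∑' k : ℕ+, Real.sin (k * a) * Real.sin (k * b) * Real.sin (k * c) *
        Real.sin (k * d) / ((k : ℕ) : ℝ) ^ 2)
      = π / 8 * (volume (triangleInterval a b ∩ triangleInterval c d)).toReal := by
  have h := hasSum_four_sin_div_sq ha0 haπ hb0 hbπ hc0 hcπ hd0 hdπ
  have hpos := (Function.Injective.hasSum_iff PNat.coe_injective (fun n hn => by
    have hn0 : n = 0 := by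
      by_contra hne
      exact hn ⟨⟨n, Nat.pos_of_ne_zero hne⟩, rfl⟩
    simp [hn0])).mpr h
  exact ⟨hpos.summable.abs, hpos.tsum_eq⟩
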